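/- The T-ideal of polynomial identities of the algebra A is generated as a T-ideal by the polynomial [x₁,x₂][x₃,x₄,x₅]; that is, T(A) = ⟨[x₁,x₂][x₃,x₄,x₅]⟩^T. -/

import Mathlib

noncomputable section

/-- `f ∈ K⟨X⟩` (with set of variables `X`) is a polynomial identity of the `K`-algebra `R`:
every substitution of elements of `R` for the variables (i.e. every `K`-algebra homomorphism
from the free algebra to `R`) kills `f`. -/
def IsPI (K : Type) [Field K] {X : Type} (R : Type) [Ring R] [Algebra K R]
    (f : FreeAlgebra K X) : Prop :=
  ∀ φ : FreeAlgebra K X →ₐ[K] R, φ f = 0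

/-- `T(R)`: the set of polynomial identities of `R` inside `K⟨x₁, x₂, …⟩`
(the free unital associative algebra on countably many variables, indexed by `ℕ`). -/
def TId (K : Type) [Field K] (R : Type) [Ring R] [Algebra K R] : Set (FreeAlgebra K ℕ) :=
  {f | IsPI K R f}

/-- A two-sided ideal of `K⟨X⟩` is a T-ideal when it is invariant under all algebra
endomorphisms of `K⟨X⟩`. -/
def IsTIdeal (K : Type) [Field K] (I : TwoSidedIdeal (FreeAlgebra K ℕ)) : Prop :=
  ∀ φ : FreeAlgebra K ℕ →ₐ[K] FreeAlgebra K ℕ, ∀ f ∈ I, φ f ∈ I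

/-- `⟨F⟩^T`: the smallest T-ideal of `K⟨X⟩` containing the set `F`. -/
def TIdealGen (K : Type) [Field K] (F : Set (FreeAlgebra K ℕ)) : Set (FreeAlgebra K ℕ) :=
  {g | ∀ I : TwoSidedIdeal (FreeAlgebra K ℕ), IsTIdeal K I → F ⊆ (I : Set (FreeAlgebra K ℕ)) → g ∈ I}

/-- The commutator `[a, b] = a * b - b * a`. -/
def br {R : Type} [Ring R] (a b : R) : R := a * b - b * a

/-- The left-normed commutator `[a, b, b, …, b]` with `k` occurrences of `b`. -/
def commPow {R : Type} [Ring R] (a b : R) (k : ℕ) : R := (fun y => br y b)^[k] a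

/-- The variable `xᵢ` of `K⟨x₁, x₂, …⟩` (1-based indexing). -/
def xv (K : Type) [Field K] (i : ℕ) : FreeAlgebra K ℕ := FreeAlgebra.ι K i

/-- The product of commutators `[x₁,x₂][x₃,x₄]⋯[x_{2k-1},x_{2k}]`. -/
def chainProd (K : Type) [Field K] (k : ℕ) : FreeAlgebra K ℕ :=
  ((List.range k).map fun i => br (xv K (2 * i + 1)) (xv K (2 * i + 2))).prod

/-- The Grassmann (exterior) algebra of an infinite dimensional `K`-vector space
with basis `e₁, e₂, …`. -/
abbrev Einf (K : Type) [Field K] : Type := ExteriorAlgebra K (ℕ →₀ K)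

/-- The Grassmann (exterior) algebra `E⁽ⁿ⁾` of an `n`-dimensional `K`-vector space. -/
abbrev Efin (K : Type) [Field K] (n : ℕ) : Type := ExteriorAlgebra K (Fin n → K)

/-- The even part `E₀` of the Grassmann algebra of `V`. -/
def evenPart (K V : Type) [Field K] [AddCommGroup V] [Module K V] :
    Submodule K (ExteriorAlgebra K V) :=
  CliffordAlgebra.evenOdd (0 : QuadraticForm K V) 0

/-- The odd part `E₁` of the Grassmann algebra of `V`. -/
def oddPart (K V : Type) [Field K] [AddCommGroup V] [Module K V] :
    Submodule K (ExteriorAlgebra K V) :=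
  CliffordAlgebra.evenOdd (0 : QuadraticForm K V) 1

section matrixAlgebras

variable (K V : Type) [Field K] [AddCommGroup V] [Module K V]

private theorem evenPart_mul_mem {a b : ExteriorAlgebra K V}
    (ha : a ∈ evenPart K V) (hb : b ∈ evenPart K V) : a * b ∈ evenPart K V := by
  have := CliffordAlgebra.evenOdd_mul_le (Q := (0 : QuadraticForm K V)) 0 0
    (Submodule.mul_mem_mul ha hb)
  simpa [evenPart] using this

private theorem evenPart_one_mem : (1 : ExteriorAlgebra K V) ∈ evenPart K V :=
  SetLike.one_mem_graded _

private theorem evenPart_algebraMap_mem (c : K) :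
    algebraMap K (ExteriorAlgebra K V) c ∈ evenPart K V :=
  SetLike.algebraMap_mem_graded _ c

/-- The algebra `A` (over the Grassmann algebra of `V`): the subalgebra of `2 × 2`
matrices over `E = Λ(V)` whose `(1,1)` entry lies in `E₀`, whose `(2,1)` entry is `0`,
and whose `(1,2)` and `(2,2)` entries are arbitrary. -/
def algA : Subalgebra K (Matrix (Fin 2) (Fin 2) (ExteriorAlgebra K V)) where
  carrier := {M | M 0 0 ∈ evenPart K V ∧ M 1 0 = 0}
  mul_mem' := by
    rintro a b ⟨ha0, ha1⟩ ⟨hb0, hb1⟩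
    refine ⟨?_, ?_⟩
    · have h : (a * b) 0 0 = a 0 0 * b 0 0 + a 0 1 * b 1 0 := by
        simp [Matrix.mul_apply, Fin.sum_univ_two]
      rw [h, hb1, mul_zero, add_zero]
      exact evenPart_mul_mem K V ha0 hb0
    · have h : (a * b) 1 0 = a 1 0 * b 0 0 + a 1 1 * b 1 0 := by
        simp [Matrix.mul_apply, Fin.sum_univ_two]
      rw [h, ha1, hb1, zero_mul, mul_zero, add_zero]
  one_mem' := by
    refine ⟨?_, ?_⟩
    · rw [Matrix.one_apply_eq]; exact evenPart_one_mem K V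
    · exact Matrix.one_apply_ne (by decide)
  add_mem' := by
    rintro a b ⟨ha0, ha1⟩ ⟨hb0, hb1⟩
    exact ⟨Submodule.add_mem _ ha0 hb0, by simp [ha1, hb1]⟩
  zero_mem' := ⟨Submodule.zero_mem _, rfl⟩
  algebraMap_mem' := fun c => by
    refine ⟨?_, ?_⟩
    · rw [Matrix.algebraMap_matrix_apply, if_pos rfl]
      exact evenPart_algebraMap_mem K V c
    · rw [Matrix.algebraMap_matrix_apply, if_neg (by decide)]

end matrixAlgebras

section matrixAlgebras2

variable (K V : Type) [Field K] [AddCommGroup V] [Module K V]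

private theorem oddPart_mul_mem_even {a b : ExteriorAlgebra K V}
    (ha : a ∈ oddPart K V) (hb : b ∈ oddPart K V) : a * b ∈ evenPart K V := by
  have := CliffordAlgebra.evenOdd_mul_le (Q := (0 : QuadraticForm K V)) 1 1
    (Submodule.mul_mem_mul ha hb)
  have h2 : ((1 : ZMod 2) + 1) = 0 := by decide
  rw [h2] at this
  exact this

private theorem even_mul_odd_mem {a b : ExteriorAlgebra K V}
    (ha : a ∈ evenPart K V) (hb : b ∈ oddPart K V) : a * b ∈ oddPart K V := by
  have := CliffordAlgebra.evenOdd_mul_le (Q := (0 : QuadraticForm K V)) 0 1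
    (Submodule.mul_mem_mul ha hb)
  rw [zero_add] at this
  exact this

private theorem odd_mul_even_mem {a b : ExteriorAlgebra K V}
    (ha : a ∈ oddPart K V) (hb : b ∈ evenPart K V) : a * b ∈ oddPart K V := by
  have := CliffordAlgebra.evenOdd_mul_le (Q := (0 : QuadraticForm K V)) 1 0
    (Submodule.mul_mem_mul ha hb)
  rw [add_zero] at this
  exact this

/-- The algebra `A′` (over the Grassmann algebra of `V`): the subalgebra of `2 × 2`
matrices over `E = Λ(V)` whose `(2,2)` entry lies in `E₀`, whose `(2,1)` entry is `0`,
and whose `(1,1)` and `(1,2)` entries are arbitrary. -/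
def algA' : Subalgebra K (Matrix (Fin 2) (Fin 2) (ExteriorAlgebra K V)) where
  carrier := {M | M 1 1 ∈ evenPart K V ∧ M 1 0 = 0}
  mul_mem' := by
    rintro a b ⟨ha0, ha1⟩ ⟨hb0, hb1⟩
    refine ⟨?_, ?_⟩
    · have h : (a * b) 1 1 = a 1 0 * b 0 1 + a 1 1 * b 1 1 := by
        simp [Matrix.mul_apply, Fin.sum_univ_two]
      rw [h, ha1, zero_mul, zero_add]
      exact evenPart_mul_mem K V ha0 hb0
    · have h : (a * b) 1 0 = a 1 0 * b 0 0 + a 1 1 * b 1 0 := by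
        simp [Matrix.mul_apply, Fin.sum_univ_two]
      rw [h, ha1, hb1, zero_mul, mul_zero, add_zero]
  one_mem' := by
    refine ⟨?_, ?_⟩
    · rw [Matrix.one_apply_eq]; exact evenPart_one_mem K V
    · exact Matrix.one_apply_ne (by decide)
  add_mem' := by
    rintro a b ⟨ha0, ha1⟩ ⟨hb0, hb1⟩
    exact ⟨Submodule.add_mem _ ha0 hb0, by simp [ha1, hb1]⟩
  zero_mem' := ⟨Submodule.zero_mem _, rfl⟩
  algebraMap_mem' := fun c => by
    refine ⟨?_, ?_⟩
    · rw [Matrix.algebraMap_matrix_apply, if_pos rfl]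
      exact evenPart_algebraMap_mem K V c
    · rw [Matrix.algebraMap_matrix_apply, if_neg (by decide)]

/-- The algebra `M_{1,1}` (over the Grassmann algebra of `V`): the subalgebra of `2 × 2`
matrices over `E = Λ(V)` whose diagonal entries lie in `E₀` and whose off-diagonal entries
lie in `E₁`. -/
def m11 : Subalgebra K (Matrix (Fin 2) (Fin 2) (ExteriorAlgebra K V)) where
  carrier := {M | M 0 0 ∈ evenPart K V ∧ M 1 1 ∈ evenPart K V ∧
    M 0 1 ∈ oddPart K V ∧ M 1 0 ∈ oddPart K V}
  mul_mem' := by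
    rintro a b ⟨ha00, ha11, ha01, ha10⟩ ⟨hb00, hb11, hb01, hb10⟩
    have h00 : (a * b) 0 0 = a 0 0 * b 0 0 + a 0 1 * b 1 0 := by
      simp [Matrix.mul_apply, Fin.sum_univ_two]
    have h11 : (a * b) 1 1 = a 1 0 * b 0 1 + a 1 1 * b 1 1 := by
      simp [Matrix.mul_apply, Fin.sum_univ_two]
    have h01 : (a * b) 0 1 = a 0 0 * b 0 1 + a 0 1 * b 1 1 := by
      simp [Matrix.mul_apply, Fin.sum_univ_two]
    have h10 : (a * b) 1 0 = a 1 0 * b 0 0 + a 1 1 * b 1 0 := by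
      simp [Matrix.mul_apply, Fin.sum_univ_two]
    refine ⟨?_, ?_, ?_, ?_⟩
    · rw [h00]
      exact Submodule.add_mem _ (evenPart_mul_mem K V ha00 hb00)
        (oddPart_mul_mem_even K V ha01 hb10)
    · rw [h11]
      exact Submodule.add_mem _ (oddPart_mul_mem_even K V ha10 hb01)
        (evenPart_mul_mem K V ha11 hb11)
    · rw [h01]
      exact Submodule.add_mem _ (even_mul_odd_mem K V ha00 hb01)
        (odd_mul_even_mem K V ha01 hb11)
    · rw [h10]
      exact Submodule.add_mem _ (odd_mul_even_mem K V ha10 hb00)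
        (even_mul_odd_mem K V ha11 hb10)
  one_mem' := by
    refine ⟨?_, ?_, ?_, ?_⟩
    · rw [Matrix.one_apply_eq]; exact evenPart_one_mem K V
    · rw [Matrix.one_apply_eq]; exact evenPart_one_mem K V
    · rw [Matrix.one_apply_ne (by decide)]; exact Submodule.zero_mem _
    · rw [Matrix.one_apply_ne (by decide)]; exact Submodule.zero_mem _
  add_mem' := by
    rintro a b ⟨ha00, ha11, ha01, ha10⟩ ⟨hb00, hb11, hb01, hb10⟩
    exact ⟨Submodule.add_mem _ ha00 hb00, Submodule.add_mem _ ha11 hb11,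
      Submodule.add_mem _ ha01 hb01, Submodule.add_mem _ ha10 hb10⟩
  zero_mem' := ⟨Submodule.zero_mem _, Submodule.zero_mem _,
    Submodule.zero_mem _, Submodule.zero_mem _⟩
  algebraMap_mem' := fun c => by
    refine ⟨?_, ?_, ?_, ?_⟩
    · rw [Matrix.algebraMap_matrix_apply, if_pos rfl]
      exact evenPart_algebraMap_mem K V c
    · rw [Matrix.algebraMap_matrix_apply, if_pos rfl]
      exact evenPart_algebraMap_mem K V c
    · rw [Matrix.algebraMap_matrix_apply, if_neg (by decide)]
      exact Submodule.zero_mem _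
    · rw [Matrix.algebraMap_matrix_apply, if_neg (by decide)]
      exact Submodule.zero_mem _

end matrixAlgebras2

/-- The relatively free algebra `F_n(R) = K⟨x₁, …, xₙ⟩ / (K⟨x₁, …, xₙ⟩ ∩ T(R))` of rank `n`
of the variety generated by `R`: the quotient of the free algebra on `n` variables by the
ideal of polynomial identities of `R` in those variables. -/
abbrev RelFree (K : Type) [Field K] (R : Type) [Ring R] [Algebra K R] (n : ℕ) : Type :=
  RingQuot (fun f g : FreeAlgebra K (Fin n) => IsPI K R (f - g))

end

section FreeAlgebraSpan

variable {K X : Type} [Field K]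

theorem FreeAlgebra.mem_of_mul_ι_mem (W : Submodule K (FreeAlgebra K X)) (h1 : 1 ∈ W)
    (h : ∀ w ∈ W, ∀ i, w * FreeAlgebra.ι K i ∈ W) (f : FreeAlgebra K X) : f ∈ W := by
  have key : ∀ f : FreeAlgebra K X, ∀ w ∈ W, w * f ∈ W := by
    intro f
    induction f using FreeAlgebra.induction with
    | grade0 r =>
      intro w hw
      rw [← Algebra.commutes, ← Algebra.smul_def]
      exact W.smul_mem r hw
    | grade1 i => exact fun w hw => h w hw i
    | mul a b ha hb =>
      intro w hw
      rw [← mul_assoc]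
      exact hb _ (ha _ hw)
    | add a b ha hb =>
      intro w hw
      rw [mul_add]
      exact W.add_mem (ha _ hw) (hb _ hw)
  simpa using key f 1 h1

theorem FreeAlgebra.lift_mem_of_mul_mem {R : Type} [Ring R] [Algebra K R] (x : X → R)
    (W : Submodule K R) (h1 : 1 ∈ W) (h : ∀ w ∈ W, ∀ i, x i * w ∈ W) (f : FreeAlgebra K X) :
    FreeAlgebra.lift K x f ∈ W := by
  have key : ∀ f : FreeAlgebra K X, ∀ w ∈ W, FreeAlgebra.lift K x f * w ∈ W := by
    intro f
    induction f using FreeAlgebra.induction with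
    | grade0 r =>
      intro w hw
      rw [AlgHom.commutes, ← Algebra.smul_def]
      exact W.smul_mem r hw
    | grade1 i =>
      intro w hw
      rw [FreeAlgebra.lift_ι_apply]
      exact h w hw i
    | mul a b ha hb =>
      intro w hw
      rw [map_mul, mul_assoc]
      exact ha _ (hb _ hw)
    | add a b ha hb =>
      intro w hw
      rw [map_add, add_mul]
      exact W.add_mem (ha _ hw) (hb _ hw)
  simpa using key f 1 h1

end FreeAlgebraSpan

section PolynomialFunctions

variable {K B : Type} [Field K] [Ring B] [Algebra K B]

/-- The `B`-valued polynomial functions on `K^ℕ` none of whose monomials lies in `S`; a monomial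
is given by the multiset of its variables. -/
def polyAvoid (K B : Type) [Field K] [Ring B] [Algebra K B] (S : Set (Multiset ℕ)) :
    Submodule K ((ℕ → K) → B) where
  carrier := {h | ∀ φ : B →ₗ[K] K, ∃ P : MvPolynomial ℕ K,
    (∀ M ∈ S, P.coeff (Multiset.toFinsupp M) = 0) ∧ ∀ c, φ (h c) = MvPolynomial.eval c P}
  add_mem' := by
    intro g h hg hh φ
    obtain ⟨P, hP, hP'⟩ := hg φ
    obtain ⟨Q, hQ, hQ'⟩ := hh φ
    refine ⟨P + Q, fun M hM => ?_, fun c => ?_⟩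
    · rw [MvPolynomial.coeff_add, hP M hM, hQ M hM, add_zero]
    · rw [Pi.add_apply, map_add, map_add, hP', hQ']
  zero_mem' := fun φ => ⟨0, by simp, by simp⟩
  smul_mem' := by
    intro r h hh φ
    obtain ⟨P, hP, hP'⟩ := hh φ
    refine ⟨r • P, fun M hM => ?_, fun c => ?_⟩
    · rw [MvPolynomial.coeff_smul, hP M hM, smul_zero]
    · rw [Pi.smul_apply, map_smul, hP', MvPolynomial.smul_eval, smul_eq_mul]

/-- The multisets with at least `n` elements. -/
def cardGE (n : ℕ) : Set (Multiset ℕ) := {M | n ≤ M.card}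

theorem cardGE_anti {m n : ℕ} (h : m ≤ n) : cardGE n ⊆ cardGE m :=
  fun _ hM => le_trans h hM

theorem singleton_subset_cardGE {M : Multiset ℕ} {n : ℕ} (h : n ≤ M.card) : {M} ⊆ cardGE n :=
  Set.singleton_subset_iff.2 h

theorem polyAvoid_anti {S T : Set (Multiset ℕ)} (h : S ⊆ T) : polyAvoid K B T ≤ polyAvoid K B S := by
  intro g hg φ
  obtain ⟨P, hP, hP'⟩ := hg φ
  exact ⟨P, fun M hM => hP M (h hM), hP'⟩

theorem polyAvoid_map {B' : Type} [Ring B'] [Algebra K B'] {S : Set (Multiset ℕ)}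
    {h : (ℕ → K) → B} (hh : h ∈ polyAvoid K B S) (ψ : B →ₗ[K] B') :
    (fun c => ψ (h c)) ∈ polyAvoid K B' S :=
  fun φ => hh (φ ∘ₗ ψ)

theorem polyAvoid_mul_const {S : Set (Multiset ℕ)} {h : (ℕ → K) → B}
    (hh : h ∈ polyAvoid K B S) (b : B) : (fun c => h c * b) ∈ polyAvoid K B S :=
  polyAvoid_map hh (LinearMap.mulRight K b)

theorem polyAvoid_const_mul {S : Set (Multiset ℕ)} {h : (ℕ → K) → B}
    (hh : h ∈ polyAvoid K B S) (b : B) : (fun c => b * h c) ∈ polyAvoid K B S :=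
  polyAvoid_map hh (LinearMap.mulLeft K b)

theorem polyAvoid_var_smul {n : ℕ} {h : (ℕ → K) → B} (hh : h ∈ polyAvoid K B (cardGE n)) (i : ℕ) :
    (fun c => c i • h c) ∈ polyAvoid K B (cardGE (n + 1)) := by
  intro φ
  obtain ⟨P, hP, hP'⟩ := hh φ
  refine ⟨P * MvPolynomial.X i, fun M hM => ?_, fun c => ?_⟩
  · by_cases hi : i ∈ M
    · obtain ⟨N, rfl⟩ := Multiset.exists_cons_of_mem hi
      rw [← Multiset.singleton_add, add_comm, Multiset.toFinsupp_add,
        Multiset.toFinsupp_singleton, MvPolynomial.coeff_mul_X]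
      refine hP N ?_
      simpa [cardGE] using hM
    · rw [MvPolynomial.coeff_mul_X', if_neg]
      simpa using hi
  · simp [hP', mul_comm]

theorem prod_X_eq_monomial (M : Multiset ℕ) :
    (M.map (MvPolynomial.X : ℕ → MvPolynomial ℕ K)).prod =
      MvPolynomial.monomial (Multiset.toFinsupp M) 1 := by
  induction M using Multiset.induction with
  | empty => simp
  | cons a M ih =>
    rw [Multiset.map_cons, Multiset.prod_cons, ih, ← Multiset.singleton_add,
      Multiset.toFinsupp_add, Multiset.toFinsupp_singleton, MvPolynomial.X,
      MvPolynomial.monomial_mul, one_mul]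

theorem eval_monomial_toFinsupp (c : ℕ → K) (M : Multiset ℕ) (r : K) :
    MvPolynomial.eval c (MvPolynomial.monomial (Multiset.toFinsupp M) r) = (M.map c).prod * r := by
  rw [← mul_one r, ← smul_eq_mul, ← MvPolynomial.smul_monomial, ← prod_X_eq_monomial,
    MvPolynomial.smul_eval, map_multiset_prod, Multiset.map_map]
  simp [mul_comm]

theorem monomial_mem_polyAvoid {S : Set (Multiset ℕ)} {M : Multiset ℕ} (hM : M ∉ S) (b : B) :
    (fun c : ℕ → K => (M.map c).prod • b) ∈ polyAvoid K B S := by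
  classical
  intro φ
  refine ⟨MvPolynomial.monomial (Multiset.toFinsupp M) (φ b), fun N hN => ?_, fun c => ?_⟩
  · rw [MvPolynomial.coeff_monomial, if_neg]
    intro h
    rw [EmbeddingLike.apply_eq_iff_eq] at h
    exact hM (h ▸ hN)
  · rw [eval_monomial_toFinsupp, map_smul, smul_eq_mul]

theorem const_mem_polyAvoid (n : ℕ) (b : B) :
    (fun _ : ℕ → K => b) ∈ polyAvoid K B (cardGE (n + 1)) := by
  simpa using monomial_mem_polyAvoid (K := K) (S := cardGE (n + 1)) (M := 0) (by simp [cardGE]) b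

theorem eq_zero_of_monomial_mem_polyAvoid [Infinite K] {S : Set (Multiset ℕ)} {M : Multiset ℕ}
    (hM : M ∈ S) {b : B} (h : (fun c : ℕ → K => (M.map c).prod • b) ∈ polyAvoid K B S) :
    b = 0 := by
  rw [← Module.forall_dual_apply_eq_zero_iff K]
  intro φ
  obtain ⟨P, hP, hP'⟩ := h φ
  have : P = MvPolynomial.monomial (Multiset.toFinsupp M) (φ b) := by
    refine MvPolynomial.funext fun c => ?_
    rw [← hP', eval_monomial_toFinsupp, map_smul, smul_eq_mul]
  simpa [this] using hP M hM

/-- `∏ (cᵢ + bᵢ)` has leading monomial `∏ cᵢ`. -/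
theorem prod_var_add_sub_mem_polyAvoid (b : ℕ → B) (l : List ℕ) :
    (fun c : ℕ → K => (l.map fun i => algebraMap K B (c i) + b i).prod -
      (Multiset.map c l).prod • (1 : B)) ∈ polyAvoid K B (cardGE l.length) := by
  induction l with
  | nil =>
    convert (polyAvoid K B (cardGE ([] : List ℕ).length)).zero_mem using 1
    funext c
    simp
  | cons i l ih =>
    have h1 := polyAvoid_var_smul ih i
    have h2 := polyAvoid_anti (cardGE_anti (Nat.le_succ _)) (polyAvoid_const_mul ih (b i))
    have h3 := monomial_mem_polyAvoid (K := K) (S := cardGE (l.length + 1))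
      (M := (l : Multiset ℕ)) (by simp [cardGE]) (b i)
    rw [List.length_cons]
    convert (polyAvoid K B _).add_mem ((polyAvoid K B _).add_mem h1 h2) h3 using 1
    funext c
    simp only [List.map_cons, List.prod_cons, Multiset.map_coe, Multiset.prod_coe, Pi.add_apply,
      Algebra.smul_def, map_mul, add_mul, mul_sub, mul_one, ← Algebra.commutes (List.prod _) (b i)]
    noncomm_ring

end PolynomialFunctions

noncomputable section

section ExteriorCommutators

variable {K V : Type} [Field K] [AddCommGroup V] [Module K V]

theorem evenPart_commute {a : ExteriorAlgebra K V} (ha : a ∈ evenPart K V)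
    (b : ExteriorAlgebra K V) : a * b = b * a := by
  have hι : ∀ u v w : V, ExteriorAlgebra.ι K u * ExteriorAlgebra.ι K v * ExteriorAlgebra.ι K w =
      ExteriorAlgebra.ι K w * (ExteriorAlgebra.ι K u * ExteriorAlgebra.ι K v) := by
    intro u v w
    have h1 := eq_neg_of_add_eq_zero_left (ExteriorAlgebra.ι_add_mul_swap (R := K) v w)
    have h2 := eq_neg_of_add_eq_zero_left (ExteriorAlgebra.ι_add_mul_swap (R := K) u w)
    rw [mul_assoc, h1, mul_neg, ← mul_assoc, h2, neg_mul, neg_neg, mul_assoc]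
  have hb : ∀ u v : V, Commute (ExteriorAlgebra.ι K u * ExteriorAlgebra.ι K v) b := by
    intro u v
    induction b using ExteriorAlgebra.induction with
    | algebraMap r => exact Algebra.commute_algebraMap_right r _
    | ι w => exact hι u v w
    | mul x y hx hy => exact hx.mul_right hy
    | add x y hx hy => exact hx.add_right hy
  change Commute a b
  induction a, ha using CliffordAlgebra.even_induction with
  | algebraMap r => exact Algebra.commute_algebraMap_left r b
  | add x y hx hy ihx ihy => exact ihx.add_left ihy
  | ι_mul_ι_mul u v x hx ih => exact (hb u v).mul_left ih

theorem br_mem_evenPart (a b : ExteriorAlgebra K V) : br a b ∈ evenPart K V := by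
  have htop : ∀ x : ExteriorAlgebra K V, x ∈ evenPart K V ⊔ oddPart K V := by
    intro x
    rw [evenPart, oddPart, (CliffordAlgebra.evenOdd_isCompl _).sup_eq_top]
    trivial
  obtain ⟨a₀, ha₀, a₁, ha₁, rfl⟩ := Submodule.mem_sup.1 (htop a)
  obtain ⟨b₀, hb₀, b₁, hb₁, rfl⟩ := Submodule.mem_sup.1 (htop b)
  have : br (a₀ + a₁) (b₀ + b₁) = a₁ * b₁ - b₁ * a₁ := by
    have h1 := evenPart_commute ha₀ b₀
    have h2 := evenPart_commute ha₀ b₁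
    have h3 := evenPart_commute hb₀ a₁
    simp only [br, add_mul, mul_add, h1, h2, h3]
    abel
  rw [this]
  exact Submodule.sub_mem _ (oddPart_mul_mem_even K V ha₁ hb₁) (oddPart_mul_mem_even K V hb₁ ha₁)

theorem br_eq_zero_of_mem_evenPart {a : ExteriorAlgebra K V} (ha : a ∈ evenPart K V)
    (b : ExteriorAlgebra K V) : br a b = 0 :=
  sub_eq_zero.2 (evenPart_commute ha b)

theorem ExteriorAlgebra.br_br_eq_zero (a b c : ExteriorAlgebra K V) : br (br a b) c = 0 :=
  br_eq_zero_of_mem_evenPart (br_mem_evenPart a b) c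

end ExteriorCommutators

section LieNilpotent

variable {K R : Type} [Field K] [Ring R] [Algebra K R]

theorem br_mem_center (hR : ∀ a b c : R, br (br a b) c = 0) (a b : R) :
    br a b ∈ Subalgebra.center K R :=
  Subalgebra.mem_center_iff.2 fun c => (sub_eq_zero.1 (hR a b c)).symm

theorem br_mul_br_eq_zero (hR : ∀ a b c : R, br (br a b) c = 0) (u v w : R) :
    br u v * br v w = 0 := by
  have h : br (br (v * w) u) v = v * br (br w u) v + br (br v u) v * w + br v u * br w v := by
    simp only [br]
    noncomm_ring
  rw [hR (v * w) u v, hR v u v, hR w u v] at h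
  have h4 : br u v * br v w = br v u * br w v := by
    simp only [br]
    noncomm_ring
  rw [h4]
  simpa using h.symm

/-- The bilinear extension of `(eᵢ, eⱼ) ↦ [xᵢ, xⱼ] / 2`. -/
def halfBr (hR : ∀ a b c : R, br (br a b) c = 0) (x : ℕ → R) :
    (ℕ →₀ K) →ₗ[K] (ℕ →₀ K) →ₗ[K] Subalgebra.center K R :=
  LinearMap.mk₂ K
    (fun u v => ⟨(2⁻¹ : K) • br (Finsupp.linearCombination K x u) (Finsupp.linearCombination K x v),
      Subalgebra.smul_mem _ (br_mem_center hR _ _) _⟩)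
    (fun u v w => Subtype.ext (by simp [br, add_mul, mul_add, ← smul_add]; abel_nf))
    (fun r u v => Subtype.ext (by simp [br, ← smul_sub, smul_comm r]))
    (fun u v w => Subtype.ext (by simp [br, add_mul, mul_add, ← smul_add]; abel_nf))
    (fun r u v => Subtype.ext (by simp [br, ← smul_sub, smul_comm r]))

theorem coe_halfBr (hR : ∀ a b c : R, br (br a b) c = 0) (x : ℕ → R) (u v : ℕ →₀ K) :
    (halfBr hR x u v : R) =
      (2⁻¹ : K) • br (Finsupp.linearCombination K x u) (Finsupp.linearCombination K x v) :=
  rfl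

/-- The algebra homomorphism from the even part of the Grassmann algebra sending `eᵢ eⱼ` to
`[xᵢ, xⱼ] / 2`. -/
def evenToCenter (hR : ∀ a b c : R, br (br a b) c = 0) (x : ℕ → R) :
    CliffordAlgebra.even (0 : QuadraticForm K (ℕ →₀ K)) →ₐ[K] Subalgebra.center K R :=
  CliffordAlgebra.even.lift 0
    { bilin := halfBr hR x
      contract := fun m => Subtype.ext (by simp [coe_halfBr, br])
      contract_mid := fun u v w => Subtype.ext (by
        simp [coe_halfBr, br_mul_br_eq_zero hR]) }

/-- The product `eᵢ eⱼ`. -/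
def evenPair (K : Type) [Field K] (i j : ℕ) :
    CliffordAlgebra.even (0 : QuadraticForm K (ℕ →₀ K)) :=
  (CliffordAlgebra.even.ι 0).bilin (Finsupp.single i 1) (Finsupp.single j 1)

theorem coe_evenToCenter_evenPair (hR : ∀ a b c : R, br (br a b) c = 0) (x : ℕ → R) (i j : ℕ) :
    (evenToCenter (K := K) hR x (evenPair K i j) : R) = (2⁻¹ : K) • br (x i) (x j) := by
  simp [evenToCenter, evenPair, coe_halfBr]

/-- The product of the `xᵢ`, `i ∈ M`, in increasing order. -/
def ordProd (x : ℕ → R) (M : Multiset ℕ) : R := ((M.sort (· ≤ ·)).map x).prod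

theorem ordProd_cons (x : ℕ → R) {a : ℕ} {M : Multiset ℕ} (h : ∀ b ∈ M, a ≤ b) :
    ordProd x (a ::ₘ M) = x a * ordProd x M := by
  rw [ordProd, Multiset.sort_cons a M (· ≤ ·) h, List.map_cons, List.prod_cons, ordProd]

/-- The span of the products `ordProd x M * ω` with `ω` in the image of `evenToCenter` and all
elements of `M` at least `b`. -/
def normalSpan (hR : ∀ a b c : R, br (br a b) c = 0) (x : ℕ → R) (b : ℕ) : Submodule K R :=
  Submodule.span K {r | ∃ (M : Multiset ℕ) (ω : CliffordAlgebra.even (0 : QuadraticForm K (ℕ →₀ K))),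
    (∀ m ∈ M, b ≤ m) ∧ r = ordProd x M * evenToCenter hR x ω}

variable (hR : ∀ a b c : R, br (br a b) c = 0) (x : ℕ → R)

theorem normalSpan_mul_mem {b : ℕ} {r : R} (hr : r ∈ normalSpan (K := K) hR x b)
    (ω : CliffordAlgebra.even (0 : QuadraticForm K (ℕ →₀ K))) :
    r * evenToCenter hR x ω ∈ normalSpan (K := K) hR x b := by
  refine (Submodule.span_le (p := (normalSpan (K := K) hR x b).comap
    (LinearMap.mulRight K (evenToCenter hR x ω : R)))).2 ?_ hr
  rintro _ ⟨M, ω', hM, rfl⟩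
  exact Submodule.subset_span ⟨M, ω' * ω, hM, by
    rw [LinearMap.mulRight_apply, map_mul, mul_assoc, MulMemClass.coe_mul]⟩

theorem normalSpan_anti {a b : ℕ} (h : a ≤ b) :
    normalSpan (K := K) hR x b ≤ normalSpan hR x a :=
  Submodule.span_mono fun _ ⟨M, ω, hM, hr⟩ => ⟨M, ω, fun m hm => h.trans (hM m hm), hr⟩

theorem mul_normalSpan_mem {b : ℕ} {r : R} (hr : r ∈ normalSpan (K := K) hR x b) :
    x b * r ∈ normalSpan (K := K) hR x b := by
  refine (Submodule.span_le (p := (normalSpan (K := K) hR x b).comap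
    (LinearMap.mulLeft K (x b)))).2 ?_ hr
  rintro _ ⟨M, ω, hM, rfl⟩
  refine Submodule.subset_span ⟨b ::ₘ M, ω, ?_, ?_⟩
  · simpa using hM
  · rw [LinearMap.mulLeft_apply, ordProd_cons x hM, mul_assoc]

theorem ordProd_mem_normalSpan {b : ℕ} {M : Multiset ℕ} (hM : ∀ m ∈ M, b ≤ m) :
    ordProd x M ∈ normalSpan (K := K) hR x b :=
  Submodule.subset_span ⟨M, 1, hM, by simp⟩

theorem mul_ordProd_mem_normalSpan [CharZero K] (l : List ℕ) (hl : l.Pairwise (· ≤ ·)) (j b : ℕ)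
    (hj : b ≤ j) (hb : ∀ m ∈ l, b ≤ m) : x j * ordProd x l ∈ normalSpan (K := K) hR x b := by
  induction l generalizing b with
  | nil =>
    exact normalSpan_anti hR x hj
      (mul_normalSpan_mem hR x (ordProd_mem_normalSpan hR x (by simp)))
  | cons a l ih =>
    rw [List.pairwise_cons] at hl
    by_cases hja : j ≤ a
    · refine normalSpan_anti hR x hj
        (mul_normalSpan_mem hR x (ordProd_mem_normalSpan hR x fun m hm => ?_))
      rcases List.mem_cons.1 (Multiset.mem_coe.1 hm) with rfl | hm
      · exact hja
      · exact hja.trans (hl.1 m hm)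
    · push Not at hja
      have hab : b ≤ a := hb a (by simp)
      have hcomm : x j * ordProd x (a :: l : List ℕ) =
          x a * (x j * ordProd x l) +
            ordProd x l * evenToCenter hR x ((2 : K) • evenPair K j a) := by
        have h := Subalgebra.mem_center_iff.1 (br_mem_center (K := K) hR (x j) (x a)) (ordProd x l)
        rw [map_smul, SetLike.val_smul, coe_evenToCenter_evenPair, smul_smul,
          mul_inv_cancel₀ two_ne_zero, one_smul, h, ← Multiset.cons_coe,
          ordProd_cons x (by simpa using hl.1), br]
        noncomm_ring
      rw [hcomm]
      refine Submodule.add_mem _ ?_ ?_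
      · exact normalSpan_anti hR x hab (mul_normalSpan_mem hR x (ih hl.2 a hja.le hl.1))
      · exact normalSpan_mul_mem hR x
          (ordProd_mem_normalSpan hR x fun m hm => hb m (List.mem_cons_of_mem a hm)) _

theorem lift_mem_normalSpan [CharZero K] (f : FreeAlgebra K ℕ) :
    FreeAlgebra.lift K x f ∈ normalSpan (K := K) hR x 0 := by
  refine FreeAlgebra.lift_mem_of_mul_mem x _ ?_ (fun w hw i => ?_) f
  · exact Submodule.subset_span ⟨0, 1, by simp, by simp [ordProd]⟩
  · refine (Submodule.span_le (p := (normalSpan (K := K) hR x 0).comap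
      (LinearMap.mulLeft K (x i)))).2 ?_ hw
    rintro _ ⟨M, ω, -, rfl⟩
    change x i * (ordProd x M * _) ∈ normalSpan hR x 0
    rw [← mul_assoc, ← Multiset.sort_eq M (· ≤ ·)]
    exact normalSpan_mul_mem hR x (mul_ordProd_mem_normalSpan hR x _
      (Multiset.pairwise_sort _ _) i 0 (Nat.zero_le _) fun m _ => Nat.zero_le m) ω

/-- Every value of a polynomial is a combination of increasing products with coefficients in the
even part of the Grassmann algebra. -/
theorem exists_normalForm [CharZero K] (f : FreeAlgebra K ℕ) :
    ∃ ω : Multiset ℕ →₀ CliffordAlgebra.even (0 : QuadraticForm K (ℕ →₀ K)),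
      FreeAlgebra.lift K x f = ω.sum fun M w => ordProd x M * (evenToCenter hR x w : R) := by
  let L : (Multiset ℕ →₀ CliffordAlgebra.even (0 : QuadraticForm K (ℕ →₀ K))) →ₗ[K] R :=
    Finsupp.lsum K fun M => LinearMap.mulLeft K (ordProd x M) ∘ₗ
      (Subalgebra.center K R).val.toLinearMap ∘ₗ (evenToCenter hR x).toLinearMap
  have hL : normalSpan (K := K) hR x 0 ≤ LinearMap.range L := by
    refine Submodule.span_le.2 ?_
    rintro _ ⟨M, ω, -, rfl⟩
    exact ⟨Finsupp.single M ω, by simp [L]⟩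
  obtain ⟨ω, hω⟩ := hL (lift_mem_normalSpan hR x f)
  exact ⟨ω, by rw [← hω]; rfl⟩

end LieNilpotent

section KrakowskiRegev

variable {K : Type} [Field K]

theorem lift_apply_of_comp {R S : Type} [Ring R] [Algebra K R] [Ring S] [Algebra K S]
    (ψ : R →ₐ[K] S) (x : ℕ → R) (f : FreeAlgebra K ℕ) :
    ψ (FreeAlgebra.lift K x f) = FreeAlgebra.lift K (fun i => ψ (x i)) f := by
  rw [← AlgHom.comp_apply]
  congr 1
  ext i
  simp

/-- The elements `cᵢ + eᵢ` of the Grassmann algebra. -/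
def grassmannPoint (c : ℕ → K) (i : ℕ) : Einf K :=
  algebraMap K (Einf K) (c i) + ExteriorAlgebra.ι K (Finsupp.single i 1)

theorem br_grassmannPoint (c : ℕ → K) (i j : ℕ) :
    br (grassmannPoint c i) (grassmannPoint c j) =
      (2 : K) • (ExteriorAlgebra.ι K (Finsupp.single i 1) *
        ExteriorAlgebra.ι K (Finsupp.single j 1)) := by
  have h := eq_neg_of_add_eq_zero_right (ExteriorAlgebra.ι_add_mul_swap (R := K)
    (Finsupp.single i (1 : K)) (Finsupp.single j 1))
  have h1 := Algebra.commutes (c i) (ExteriorAlgebra.ι K (Finsupp.single j (1 : K)))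
  have h2 := Algebra.commutes (c j) (ExteriorAlgebra.ι K (Finsupp.single i (1 : K)))
  have h3 := Algebra.commutes (c i) (algebraMap K (Einf K) (c j))
  rw [br, grassmannPoint, grassmannPoint, two_smul]
  simp only [add_mul, mul_add, h, h1, h2, h3]
  abel

variable [CharZero K]

theorem eq_zero_of_sum_ordProd_eq_zero
    (ω : Multiset ℕ →₀ CliffordAlgebra.even (0 : QuadraticForm K (ℕ →₀ K)))
    (h : ∀ c : ℕ → K, (ω.sum fun M w => ordProd (grassmannPoint c) M * (w : Einf K)) = 0) :
    ω = 0 := by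
  by_contra hω
  obtain ⟨N, hN, hmax⟩ := ω.support.exists_max_image Multiset.card (Finsupp.support_nonempty_iff.2 hω)
  rw [Finsupp.mem_support_iff] at hN
  have hlead : ∀ M ∈ ω.support, (fun c : ℕ → K => ordProd (grassmannPoint c) M * (ω M : Einf K) -
      (M.map c).prod • (ω M : Einf K)) ∈ polyAvoid K (Einf K) {N} := by
    intro M hM
    have h1 := prod_var_add_sub_mem_polyAvoid (K := K)
      (fun i => ExteriorAlgebra.ι K (Finsupp.single i (1 : K))) (M.sort (· ≤ ·))
    rw [Multiset.length_sort, Multiset.sort_eq] at h1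
    have h2 := polyAvoid_mul_const
      (polyAvoid_anti (singleton_subset_cardGE (hmax M hM)) h1) (ω M : Einf K)
    simp only [sub_mul, smul_mul_assoc, one_mul] at h2
    exact h2
  refine hN (Subtype.ext (eq_zero_of_monomial_mem_polyAvoid (K := K) (Set.mem_singleton N) ?_))
  have hrest := Submodule.sum_mem (p := polyAvoid K (Einf K) {N}) (t := ω.support.erase N)
    (f := fun M c => (M.map c).prod • (ω M : Einf K)) fun M hM =>
      monomial_mem_polyAvoid (by simpa using Finset.ne_of_mem_erase hM) _
  have hall := Submodule.sum_mem _ hlead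
  have hN' : N ∈ ω.support := Finsupp.mem_support_iff.2 hN
  convert Submodule.neg_mem _ (Submodule.add_mem _ hall hrest) using 1
  funext c
  have hc := h c
  rw [Finsupp.sum] at hc
  simp only [Pi.neg_apply, Pi.add_apply, Finset.sum_apply, Finset.sum_sub_distrib, hc]
  rw [← Finset.add_sum_erase _ _ hN']
  abel

/-- The identities of the Grassmann algebra follow from `[x₁, x₂, x₃]`. -/
theorem mem_of_forall_lift_eq_zero (J : TwoSidedIdeal (FreeAlgebra K ℕ))
    (hJ : ∀ a b c, br (br a b) c ∈ J) (g : FreeAlgebra K ℕ)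
    (hg : ∀ t : ℕ → Einf K, FreeAlgebra.lift K t g = 0) : g ∈ J := by
  let R := J.ringCon.Quotient × ((ℕ → K) → Einf K)
  let q : FreeAlgebra K ℕ →ₐ[K] J.ringCon.Quotient := RingCon.mkₐ K J.ringCon
  have hq : ∀ f, q f = 0 ↔ f ∈ J := fun f => RingCon.eq J.ringCon
  have hR : ∀ a b c : R, br (br a b) c = 0 := by
    intro a b c
    refine Prod.ext ?_ (funext fun s => ExteriorAlgebra.br_br_eq_zero (a.2 s) (b.2 s) (c.2 s))
    obtain ⟨a', ha⟩ := RingCon.mkₐ_surjective (α := K) J.ringCon a.1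
    obtain ⟨b', hb⟩ := RingCon.mkₐ_surjective (α := K) J.ringCon b.1
    obtain ⟨c', hc⟩ := RingCon.mkₐ_surjective (α := K) J.ringCon c.1
    change br (br a.1 b.1) c.1 = 0
    rw [← ha, ← hb, ← hc, ← (hq _).2 (hJ a' b' c')]
    simp only [br, q, map_sub, map_mul]
  let x : ℕ → R := fun i => (q (FreeAlgebra.ι K i), fun c => grassmannPoint c i)
  obtain ⟨ω, hω⟩ := exists_normalForm (K := K) hR x g
  let π : (ℕ → K) → R →ₐ[K] Einf K := fun c =>
    (Pi.evalAlgHom K (fun _ : ℕ → K => Einf K) c).comp (AlgHom.snd K _ _)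
  have hπ : ∀ c (w : CliffordAlgebra.even (0 : QuadraticForm K (ℕ →₀ K))),
      π c (evenToCenter hR x w : R) = (w : Einf K) := by
    intro c w
    have : ((π c).comp (Subalgebra.center K R).val).comp (evenToCenter hR x) =
        (CliffordAlgebra.even (0 : QuadraticForm K (ℕ →₀ K))).val := by
      refine CliffordAlgebra.even.algHom_ext _ (CliffordAlgebra.EvenHom.ext ?_)
      ext i j
      have hx : ∀ k, π c (x k) = grassmannPoint c k := fun k => rfl
      have h := congrArg (π c) (coe_evenToCenter_evenPair (K := K) hR x i j)
      have hbr : π c (br (x i) (x j)) = br (grassmannPoint c i) (grassmannPoint c j) := by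
        rw [br, map_sub, map_mul, map_mul, hx, hx, br]
      rw [map_smul, hbr, br_grassmannPoint, smul_smul, inv_mul_cancel₀ two_ne_zero, one_smul] at h
      exact h
    exact DFunLike.congr_fun this w
  have hω0 : ω = 0 := by
    refine eq_zero_of_sum_ordProd_eq_zero ω fun c => ?_
    have h := congrArg (π c) hω
    rw [lift_apply_of_comp, hg, Finsupp.sum, map_sum] at h
    rw [h]
    refine Finset.sum_congr rfl fun M _ => ?_
    rw [map_mul, hπ, ordProd, map_list_prod, List.map_map]
    rfl
  rw [hω0, Finsupp.sum_zero_index] at hω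
  have h := congrArg (AlgHom.fst K _ _) hω
  rw [lift_apply_of_comp, map_zero] at h
  rw [← hq, ← h]
  change _ = FreeAlgebra.lift K (q ∘ FreeAlgebra.ι K) g
  rw [FreeAlgebra.lift_comp_ι]

end KrakowskiRegev

section Triangular

variable {K : Type} [Field K]

/-- The monomial of the free algebra given by a list of variables. -/
def word (K : Type) [Field K] (l : List ℕ) : FreeAlgebra K ℕ := (l.map (FreeAlgebra.ι K)).prod

/-- The increasing monomial with variables `M`. -/
def sortedWord (K : Type) [Field K] (M : Multiset ℕ) : FreeAlgebra K ℕ := word K (M.sort (· ≤ ·))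

/-- The difference between the increasing monomial `M` times `xⱼ` and its increasing rearrangement. -/
def straightening (K : Type) [Field K] (p : Multiset ℕ × ℕ) : FreeAlgebra K ℕ :=
  sortedWord K p.1 * FreeAlgebra.ι K p.2 - sortedWord K (p.2 ::ₘ p.1)

theorem sortedWord_mul_ι (M : Multiset ℕ) (j : ℕ) :
    sortedWord K M * FreeAlgebra.ι K j = word K (M.sort (· ≤ ·) ++ [j]) := by
  simp [sortedWord, word]

theorem straightening_eq_zero {p : Multiset ℕ × ℕ} (h : ∀ m ∈ p.1, m ≤ p.2) :
    straightening K p = 0 := by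
  rw [straightening, sortedWord_mul_ι, sortedWord, sub_eq_zero]
  congr 1
  refine List.Perm.eq_of_pairwise' (r := (· ≤ ·)) ?_ (Multiset.pairwise_sort _ _) ?_
  · rw [List.pairwise_append]
    exact ⟨Multiset.pairwise_sort _ _, List.pairwise_singleton _ _, by simpa using h⟩
  · rw [← Multiset.coe_eq_coe, Multiset.sort_eq, ← Multiset.coe_add, Multiset.sort_eq, add_comm]
    rfl

/-- Every polynomial is a combination of increasing monomials modulo the right ideal generated by
the straightening relations. -/
theorem exists_straightened (f : FreeAlgebra K ℕ) :
    ∃ (a : Multiset ℕ →₀ K) (g : Multiset ℕ × ℕ →₀ FreeAlgebra K ℕ),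
      f = (a.sum fun M r => r • sortedWord K M) + g.sum fun p u => straightening K p * u := by
  let W : Submodule K (FreeAlgebra K ℕ) := Submodule.span K
    (Set.range (sortedWord K) ∪ {u | ∃ p v, u = straightening K p * v})
  have hf : f ∈ W := by
    refine FreeAlgebra.mem_of_mul_ι_mem W ?_ (fun w hw j => ?_) f
    · exact Submodule.subset_span (Or.inl ⟨0, by simp [sortedWord, word]⟩)
    · refine (Submodule.span_le (p := W.comap (LinearMap.mulRight K (FreeAlgebra.ι K j)))).2 ?_ hw
      rintro _ (⟨M, rfl⟩ | ⟨p, v, rfl⟩)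
      · have : sortedWord K M * FreeAlgebra.ι K j =
            sortedWord K (j ::ₘ M) + straightening K (M, j) * 1 := by
          simp [straightening]
        change sortedWord K M * FreeAlgebra.ι K j ∈ W
        rw [this]
        exact W.add_mem (Submodule.subset_span (Or.inl ⟨_, rfl⟩))
          (Submodule.subset_span (Or.inr ⟨_, _, rfl⟩))
      · exact Submodule.subset_span (Or.inr ⟨p, v * FreeAlgebra.ι K j, mul_assoc _ _ _⟩)
  let L₁ : (Multiset ℕ →₀ K) →ₗ[K] FreeAlgebra K ℕ := Finsupp.linearCombination K (sortedWord K)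
  let L₂ : (Multiset ℕ × ℕ →₀ FreeAlgebra K ℕ) →ₗ[K] FreeAlgebra K ℕ :=
    Finsupp.lsum K fun p => LinearMap.mulLeft K (straightening K p)
  have hW : W ≤ LinearMap.range L₁ ⊔ LinearMap.range L₂ := by
    refine Submodule.span_le.2 ?_
    rintro _ (⟨M, rfl⟩ | ⟨p, v, rfl⟩)
    · exact Submodule.mem_sup_left ⟨Finsupp.single M 1, by simp [L₁]⟩
    · exact Submodule.mem_sup_right ⟨Finsupp.single p v, by simp [L₂]⟩
  obtain ⟨_, ⟨a, rfl⟩, _, ⟨g, rfl⟩, h⟩ := Submodule.mem_sup.1 (hW hf)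
  exact ⟨a, g, h.symm⟩

/-- The representation of the free algebra by upper triangular matrices over the Grassmann algebra
with `xᵢ ↦ (cᵢ, δᵢⱼ; 0, tᵢ)`. -/
def triRep (c : ℕ → K) (j : ℕ) (t : ℕ → Einf K) : FreeAlgebra K ℕ →ₐ[K] algA K (ℕ →₀ K) :=
  FreeAlgebra.lift K fun i =>
    ⟨!![algebraMap K (Einf K) (c i), if i = j then 1 else 0; 0, t i],
      evenPart_algebraMap_mem K _ (c i), rfl⟩

/-- The entries of `triRep`. -/
def triEntry (c : ℕ → K) (j : ℕ) (t : ℕ → Einf K) (f : FreeAlgebra K ℕ) (a b : Fin 2) : Einf K :=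
  (triRep c j t f).1 a b

variable (c : ℕ → K) (j : ℕ) (t : ℕ → Einf K)

theorem triEntry_ι (i : ℕ) (a b : Fin 2) : triEntry c j t (FreeAlgebra.ι K i) a b =
    !![algebraMap K (Einf K) (c i), if i = j then 1 else 0; 0, t i] a b := by
  rw [triEntry, triRep, FreeAlgebra.lift_ι_apply]

theorem triEntry_add (f g : FreeAlgebra K ℕ) (a b : Fin 2) :
    triEntry c j t (f + g) a b = triEntry c j t f a b + triEntry c j t g a b := by
  simp [triEntry]

theorem triEntry_sub (f g : FreeAlgebra K ℕ) (a b : Fin 2) :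
    triEntry c j t (f - g) a b = triEntry c j t f a b - triEntry c j t g a b := by
  simp [triEntry]

theorem triEntry_smul (r : K) (f : FreeAlgebra K ℕ) (a b : Fin 2) :
    triEntry c j t (r • f) a b = r • triEntry c j t f a b := by
  simp [triEntry]

theorem triEntry_sum {ι : Type} (s : Finset ι) (f : ι → FreeAlgebra K ℕ) (a b : Fin 2) :
    triEntry c j t (∑ i ∈ s, f i) a b = ∑ i ∈ s, triEntry c j t (f i) a b := by
  simp [triEntry, Matrix.sum_apply]

theorem triEntry_mul (f g : FreeAlgebra K ℕ) (a b : Fin 2) :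
    triEntry c j t (f * g) a b =
      triEntry c j t f a 0 * triEntry c j t g 0 b + triEntry c j t f a 1 * triEntry c j t g 1 b := by
  simp [triEntry, Matrix.mul_apply, Fin.sum_univ_two]

theorem triEntry_one_zero (f : FreeAlgebra K ℕ) : triEntry c j t f 1 0 = 0 :=
  (triRep c j t f).2.2

theorem triEntry_one_one (f : FreeAlgebra K ℕ) :
    triEntry c j t f 1 1 = FreeAlgebra.lift K t f := by
  induction f using FreeAlgebra.induction with
  | grade0 r => simp [triEntry, Matrix.algebraMap_matrix_apply]
  | grade1 i => simp [triEntry_ι]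
  | mul f g hf hg => rw [triEntry_mul, triEntry_one_zero, hf, hg, map_mul, zero_mul, zero_add]
  | add f g hf hg => rw [triEntry_add, hf, hg, map_add]

theorem triEntry_word_zero_zero (l : List ℕ) :
    triEntry c j t (word K l) 0 0 = algebraMap K (Einf K) (l.map c).prod := by
  induction l with
  | nil => simp [triEntry, word]
  | cons i l ih =>
    have : word K (i :: l) = FreeAlgebra.ι K i * word K l := by simp [word]
    rw [this, triEntry_mul, triEntry_one_zero, ih, triEntry_ι]
    simp

theorem triEntry_sortedWord_zero_zero (M : Multiset ℕ) :
    triEntry c j t (sortedWord K M) 0 0 = algebraMap K (Einf K) (M.map c).prod := by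
  rw [sortedWord, triEntry_word_zero_zero, ← Multiset.prod_coe, ← Multiset.map_coe,
    Multiset.sort_eq]

theorem triEntry_straightening_zero_zero (p : Multiset ℕ × ℕ) :
    triEntry c j t (straightening K p) 0 0 = 0 := by
  rw [straightening, triEntry_sub, triEntry_mul, triEntry_one_zero, triEntry_sortedWord_zero_zero,
    triEntry_sortedWord_zero_zero, triEntry_ι]
  simp only [Matrix.of_apply, Matrix.cons_val', Matrix.cons_val_zero, mul_zero, add_zero,
    Multiset.map_cons, Multiset.prod_cons, map_mul]
  exact sub_eq_zero.2 (Algebra.commutes _ _).symm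

theorem triEntry_word_mem_polyAvoid (l : List ℕ) :
    (fun c : ℕ → K => triEntry c j t (word K l) 0 1) ∈ polyAvoid K (Einf K) (cardGE l.length) := by
  induction l with
  | nil =>
    convert (polyAvoid K (Einf K) (cardGE ([] : List ℕ).length)).zero_mem using 1
    funext c
    simp [word, triEntry]
  | cons i l ih =>
    have h1 := polyAvoid_var_smul ih i
    have h2 := const_mem_polyAvoid (K := K) l.length
      ((if i = j then 1 else 0) * FreeAlgebra.lift K t (word K l))
    rw [List.length_cons]
    convert Submodule.add_mem _ h1 h2 using 1
    funext c
    have : word K (i :: l) = FreeAlgebra.ι K i * word K l := by simp [word]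
    rw [this, triEntry_mul, triEntry_one_one, triEntry_ι, triEntry_ι]
    simp [Algebra.smul_def]

theorem triEntry_word_append_mem_polyAvoid (l : List ℕ) (i : ℕ) :
    (fun c : ℕ → K => triEntry c j t (word K (l ++ [i])) 0 1 -
      (Multiset.map c l).prod • (if i = j then 1 else 0 : Einf K)) ∈
        polyAvoid K (Einf K) (cardGE l.length) := by
  convert polyAvoid_mul_const (triEntry_word_mem_polyAvoid j t l) (t i) using 1
  funext c
  have : word K (l ++ [i]) = word K l * FreeAlgebra.ι K i := by simp [word]
  rw [this, triEntry_mul, triEntry_word_zero_zero, triEntry_ι, triEntry_ι]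
  simp [Algebra.smul_def]

theorem triEntry_sortedWord_mem_polyAvoid {M N : Multiset ℕ} (h : M.card ≤ N.card + 1)
    (hN : ∃ n ∈ N, j < n) :
    (fun c : ℕ → K => triEntry c j t (sortedWord K M) 0 1) ∈ polyAvoid K (Einf K) {N} := by
  have hlen := Multiset.length_sort (s := M) (r := (· ≤ ·))
  have hsort := Multiset.pairwise_sort M (· ≤ ·)
  rw [show sortedWord K M = word K (M.sort (· ≤ ·)) from rfl]
  rcases List.eq_nil_or_concat (M.sort (· ≤ ·)) with h0 | ⟨l, i, hl⟩
  · rw [h0]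
    exact polyAvoid_anti (singleton_subset_cardGE (Nat.zero_le _))
      (triEntry_word_mem_polyAvoid j t [])
  · rw [List.concat_eq_append] at hl
    rw [hl] at hlen hsort ⊢
    rw [List.length_append, List.length_singleton] at hlen
    have h1 := polyAvoid_anti (singleton_subset_cardGE (M := N) (by omega))
      (triEntry_word_append_mem_polyAvoid (K := K) j t l i)
    have h2 : (fun c : ℕ → K => (Multiset.map c l).prod • (if i = j then 1 else 0 : Einf K)) ∈
        polyAvoid K (Einf K) {N} := by
      split_ifs with hij
      · refine monomial_mem_polyAvoid (fun hlN => ?_) _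
        obtain ⟨n, hn, hjn⟩ := hN
        rw [← Set.mem_singleton_iff.1 hlN, Multiset.mem_coe] at hn
        have := (List.pairwise_append.1 hsort).2.2 n hn i (by simp)
        omega
      · simp only [smul_zero]
        exact Submodule.zero_mem _
    simpa only [Pi.add_def, sub_add_cancel] using Submodule.add_mem _ h1 h2

theorem triEntry_straightening_mem_polyAvoid {p : Multiset ℕ × ℕ} {N : Multiset ℕ}
    (h : p.1.card ≤ N.card) (hN : ∃ n ∈ N, j < n) :
    (fun c : ℕ → K => triEntry c j t (straightening K p) 0 1 -
      (p.1.map c).prod • (if p.2 = j then 1 else 0 : Einf K)) ∈ polyAvoid K (Einf K) {N} := by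
  have h1 := triEntry_word_append_mem_polyAvoid (K := K) j t (p.1.sort (· ≤ ·)) p.2
  rw [Multiset.length_sort, Multiset.sort_eq] at h1
  have h2 := triEntry_sortedWord_mem_polyAvoid (K := K) j t (M := p.2 ::ₘ p.1) (N := N)
    (by simpa using h) hN
  convert Submodule.sub_mem _ (polyAvoid_anti (singleton_subset_cardGE h) h1) h2 using 1
  funext c
  rw [straightening, triEntry_sub, sortedWord_mul_ι, Pi.sub_apply]
  abel

variable [CharZero K]

theorem sortedWord_coeff_eq_zero (a : Multiset ℕ →₀ K) (g : Multiset ℕ × ℕ →₀ FreeAlgebra K ℕ)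
    (h : IsPI K (algA K (ℕ →₀ K))
      ((a.sum fun M r => r • sortedWord K M) + g.sum fun p u => straightening K p * u)) :
    a = 0 := by
  by_contra ha
  obtain ⟨N, hN⟩ := Finsupp.support_nonempty_iff.2 ha
  have haN := Finsupp.mem_support_iff.1 hN
  refine haN ((algebraMap K (Einf K)).injective ?_)
  rw [map_zero]
  refine eq_zero_of_monomial_mem_polyAvoid (K := K) (Set.mem_singleton N) ?_
  have hrest := Submodule.sum_mem (p := polyAvoid K (Einf K) {N}) (t := a.support.erase N)
    (f := fun M c => (M.map c).prod • algebraMap K (Einf K) (a M)) fun M hM =>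
      monomial_mem_polyAvoid (by simpa using Finset.ne_of_mem_erase hM) _
  convert Submodule.neg_mem _ hrest using 1
  funext c
  have hc : triEntry c 0 0 _ 0 0 = 0 := congrArg (fun A => A.1 0 0) (h (triRep c 0 0))
  rw [triEntry_add, Finsupp.sum, Finsupp.sum, triEntry_sum, triEntry_sum] at hc
  simp only [triEntry_mul, triEntry_smul, triEntry_straightening_zero_zero, triEntry_one_zero,
    triEntry_sortedWord_zero_zero, mul_zero, zero_mul, add_zero, Finset.sum_const_zero] at hc
  rw [← Finset.add_sum_erase _ _ hN] at hc
  rw [Pi.neg_apply, Finset.sum_apply]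
  refine eq_neg_of_add_eq_zero_left (Eq.trans ?_ hc)
  simp only [Algebra.smul_def, ← map_mul, mul_comm]

theorem straightening_coeff_eq_zero (g : Multiset ℕ × ℕ →₀ FreeAlgebra K ℕ)
    (h : IsPI K (algA K (ℕ →₀ K)) (g.sum fun p u => straightening K p * u))
    (p : Multiset ℕ × ℕ) (hp : ∃ m ∈ p.1, p.2 < m) (t : ℕ → Einf K) :
    FreeAlgebra.lift K t (g p) = 0 := by
  classical
  by_contra hpt
  let s := g.support.filter fun p => (∃ m ∈ p.1, p.2 < m) ∧ FreeAlgebra.lift K t (g p) ≠ 0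
  have hs : s.Nonempty := ⟨p, by
    rw [Finset.mem_filter, Finsupp.mem_support_iff]
    exact ⟨fun h0 => hpt (by rw [h0, map_zero]), hp, hpt⟩⟩
  obtain ⟨q, hq, hmax⟩ := s.exists_max_image (fun p => p.1.card) hs
  obtain ⟨hqs, hqb, hqt⟩ := Finset.mem_filter.1 hq
  have hterm : ∀ p ∈ g.support.erase q, (fun c : ℕ → K =>
      triEntry c q.2 t (straightening K p) 0 1 * FreeAlgebra.lift K t (g p)) ∈
        polyAvoid K (Einf K) {q.1} := by
    intro p hp
    obtain ⟨hpq, hpg⟩ := Finset.mem_erase.1 hp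
    by_cases hps : p ∈ s
    · refine polyAvoid_mul_const ?_ _
      have h1 := triEntry_straightening_mem_polyAvoid (K := K) q.2 t (hmax p hps) hqb
      have h2 : (fun c : ℕ → K => (p.1.map c).prod • (if p.2 = q.2 then 1 else 0 : Einf K)) ∈
          polyAvoid K (Einf K) {q.1} := by
        split_ifs with hj
        · exact monomial_mem_polyAvoid (K := K) (B := Einf K)
            (fun hM => hpq (Prod.ext (Set.mem_singleton_iff.1 hM) hj)) 1
        · simp only [smul_zero]
          exact Submodule.zero_mem _
      simpa only [Pi.add_def, sub_add_cancel] using Submodule.add_mem _ h1 h2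
    · convert Submodule.zero_mem (polyAvoid K (Einf K) {q.1}) using 1
      funext c
      by_cases hb : ∃ m ∈ p.1, p.2 < m
      · have : FreeAlgebra.lift K t (g p) = 0 := by
          by_contra h0
          exact hps (Finset.mem_filter.2 ⟨hpg, hb, h0⟩)
        rw [this, mul_zero, Pi.zero_apply]
      · push Not at hb
        rw [straightening_eq_zero hb]
        simp [triEntry]
  refine hqt (eq_zero_of_monomial_mem_polyAvoid (K := K) (Set.mem_singleton q.1) ?_)
  have hlead := polyAvoid_mul_const (triEntry_straightening_mem_polyAvoid (K := K) q.2 t le_rfl hqb)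
    (FreeAlgebra.lift K t (g q))
  convert Submodule.neg_mem _ (Submodule.add_mem _ hlead (Submodule.sum_mem _ hterm)) using 1
  funext c
  have hc : triEntry c q.2 t _ 0 1 = 0 := congrArg (fun A => A.1 0 1) (h (triRep c q.2 t))
  rw [Finsupp.sum, triEntry_sum] at hc
  simp only [triEntry_mul, triEntry_straightening_zero_zero, triEntry_one_one, zero_mul,
    zero_add] at hc
  rw [← Finset.add_sum_erase _ _ hqs] at hc
  rw [Pi.neg_apply, Pi.add_apply, Finset.sum_apply, sub_mul, sub_add_eq_add_sub, hc]
  simp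

end Triangular

section TIdeals

variable {K : Type} [Field K]

/-- `T(R)` as a two-sided ideal. -/
def TIdIdeal (K : Type) [Field K] (R : Type) [Ring R] [Algebra K R] :
    TwoSidedIdeal (FreeAlgebra K ℕ) :=
  TwoSidedIdeal.mk' (TId K R) (fun φ => map_zero φ)
    (fun hf hg φ => by rw [map_add, hf φ, hg φ, add_zero])
    (fun hf φ => by rw [map_neg, hf φ, neg_zero])
    (fun hf φ => by rw [map_mul, hf φ, mul_zero])
    (fun hf φ => by rw [map_mul, hf φ, zero_mul])

theorem TIdealGen_subset_TId {R : Type} [Ring R] [Algebra K R] {F : Set (FreeAlgebra K ℕ)}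
    (hF : F ⊆ TId K R) : TIdealGen K F ⊆ TId K R := by
  intro g hg
  have hmem : ∀ f, f ∈ TIdIdeal K R ↔ f ∈ TId K R := fun f => TwoSidedIdeal.mem_mk' ..
  refine (hmem g).1 (hg _ (fun φ f hf => ?_) fun f hf => (hmem f).2 (hF hf))
  rw [hmem] at hf ⊢
  exact fun ψ => hf (ψ.comp φ)

theorem br_mul_br_br_algA_eq_zero {V : Type} [AddCommGroup V] [Module K V]
    (a b c d e : algA K V) : br a b * br (br c d) e = 0 := by
  have h10 : ∀ x : algA K V, x.1 1 0 = 0 := fun x => x.2.2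
  have hbr : ∀ (x y : algA K V) (i j : Fin 2), (br x y).1 i j =
      (x.1 i 0 * y.1 0 j + x.1 i 1 * y.1 1 j) - (y.1 i 0 * x.1 0 j + y.1 i 1 * x.1 1 j) := by
    intro x y i j
    simp [br, Matrix.mul_apply, Fin.sum_univ_two]
  have h00 : ∀ x y : algA K V, (br x y).1 0 0 = 0 := by
    intro x y
    rw [hbr, h10, h10, evenPart_commute x.2.1]
    simp
  have h11 : ∀ x y : algA K V, (br x y).1 1 1 = br (x.1 1 1) (y.1 1 1) := by
    intro x y
    rw [hbr, h10, h10, br]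
    simp
  have h11' : (br (br c d) e).1 1 1 = 0 := by
    rw [h11, h11, ExteriorAlgebra.br_br_eq_zero]
  refine Subtype.ext (Matrix.ext fun i j => ?_)
  have hmul : (br a b * br (br c d) e).1 i j =
      (br a b).1 i 0 * (br (br c d) e).1 0 j + (br a b).1 i 1 * (br (br c d) e).1 1 j := by
    simp [Matrix.mul_apply, Fin.sum_univ_two]
  rw [hmul]
  fin_cases i <;> fin_cases j <;> simp [h00, h11', h10]

/-- In a T-ideal containing `[x₁,x₂][x₃,x₄,x₅]`, the differences of rearranged words annihilate
triple commutators on the left. -/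
theorem word_sub_word_mul_mem {I : TwoSidedIdeal (FreeAlgebra K ℕ)}
    (hI : ∀ a b c d e, br a b * br (br c d) e ∈ I) {l₁ l₂ : List ℕ} (h : l₁.Perm l₂)
    (z c d e : FreeAlgebra K ℕ) : (word K l₁ - word K l₂) * z * br (br c d) e ∈ I := by
  have hmid : ∀ a b y, br a b * y * br (br c d) e ∈ I := by
    intro a b y
    have h2 := hI a (b * y) c d e
    have h3 := I.mul_mem_left b _ (hI a y c d e)
    have : br a b * y * br (br c d) e =
        br a (b * y) * br (br c d) e - b * (br a y * br (br c d) e) := by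
      simp only [br]
      noncomm_ring
    rw [this]
    exact I.sub_mem h2 h3
  induction h generalizing z with
  | nil => simp
  | cons i _ ih =>
    have := I.mul_mem_left (FreeAlgebra.ι K i) _ (ih z)
    simpa [word, mul_sub, mul_assoc, sub_mul] using this
  | swap i k l =>
    have := hmid (FreeAlgebra.ι K k) (FreeAlgebra.ι K i) (word K l * z)
    simpa [word, br, mul_sub, mul_assoc, sub_mul] using this
  | trans _ _ ih₁ ih₂ =>
    have := I.add_mem (ih₁ z) (ih₂ z)
    rwa [← add_mul, ← add_mul, sub_add_sub_cancel] at this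

theorem straightening_mul_mem [CharZero K] {I : TwoSidedIdeal (FreeAlgebra K ℕ)}
    (hI : ∀ a b c d e, br a b * br (br c d) e ∈ I) (p : Multiset ℕ × ℕ) {g : FreeAlgebra K ℕ}
    (hg : ∀ t : ℕ → Einf K, FreeAlgebra.lift K t g = 0) : straightening K p * g ∈ I := by
  let J : TwoSidedIdeal (FreeAlgebra K ℕ) :=
    TwoSidedIdeal.mk' {u | ∀ z, straightening K p * z * u ∈ I}
      (fun z => by rw [mul_zero]; exact I.zero_mem)
      (fun hu hv z => by rw [mul_add]; exact I.add_mem (hu z) (hv z))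
      (fun hu z => by rw [mul_neg]; exact I.neg_mem (hu z))
      (fun {y _} hu z => by rw [← mul_assoc, mul_assoc _ z y]; exact hu (z * y))
      (fun hu z => by rw [← mul_assoc]; exact I.mul_mem_right _ _ (hu z))
  have hmem : ∀ u, u ∈ J ↔ ∀ z, straightening K p * z * u ∈ I := fun u => TwoSidedIdeal.mem_mk' ..
  have hgJ : g ∈ J := by
    refine mem_of_forall_lift_eq_zero J (fun a b c => (hmem _).2 fun z => ?_) g hg
    rw [straightening, sortedWord_mul_ι, sortedWord]
    refine word_sub_word_mul_mem hI ?_ z a b c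
    rw [← Multiset.coe_eq_coe, Multiset.sort_eq, ← Multiset.coe_add, Multiset.sort_eq, add_comm]
    rfl
  simpa using (hmem g).1 hgJ 1

end TIdeals

end

/-- The T-ideal of polynomial identities of the algebra `A` is generated
as a T-ideal by `[x₁,x₂][x₃,x₄,x₅]`. -/
theorem tideal_algA_eq_gen (K : Type) [Field K] [CharZero K] :
    TId K (↥(algA K (ℕ →₀ K))) =
      TIdealGen K {br (xv K 1) (xv K 2) * br (br (xv K 3) (xv K 4)) (xv K 5)} := by
  refine Set.Subset.antisymm (fun f hf I hT hgen => ?_) (TIdealGen_subset_TId ?_)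
  · have hI : ∀ a b c d e, br a b * br (br c d) e ∈ I := by
      intro a b c d e
      have := hT (FreeAlgebra.lift K fun i =>
        if i = 1 then a else if i = 2 then b else if i = 3 then c else if i = 4 then d else e) _
        (hgen rfl)
      simpa [br, xv] using this
    obtain ⟨a, g, rfl⟩ := exists_straightened f
    have ha := sortedWord_coeff_eq_zero a g hf
    rw [ha, Finsupp.sum_zero_index, zero_add] at hf ⊢
    refine sum_mem fun p _ => ?_
    change straightening K p * g p ∈ I
    by_cases hp : ∃ m ∈ p.1, p.2 < m
    · exact straightening_mul_mem hI p fun t => straightening_coeff_eq_zero g hf p hp t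
    · push Not at hp
      rw [straightening_eq_zero hp, zero_mul]
      exact I.zero_mem
  · rintro _ rfl φ
    have h := br_mul_br_br_algA_eq_zero (φ (xv K 1)) (φ (xv K 2)) (φ (xv K 3)) (φ (xv K 4))
      (φ (xv K 5))
    simpa only [br, map_mul, map_sub] using h
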